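/- Let H be a real Hilbert space, C ⊆ H nonempty closed convex, T: C → C nonexpansive with Fix(T) ≠ ∅, and f: C → C a ρ-contraction with ρ ∈ [0,1). Under conditions νₙ → 0, ∑νₙ = ∞, and (δₙ/νₙ)‖xₙ − xₙ₋₁‖ → 0, with {ψₙ} ⊂ [a,b] ⊂ (0,1), the sequence defined by wₙ = xₙ + δₙ(xₙ − xₙ₋₁), yₙ = ψₙwₙ + (1−ψₙ)Twₙ, xₙ₊₁ = νₙf(xₙ) + (1−νₙ)yₙ converges strongly to the unique z ∈ Fix(T) with z = P_{Fix(T)}f(z). -/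

import Mathlib

open Filter Topology

/-- A sequence with `s (n + 1) ≤ (1 - γ n) * s n + γ n * ε` eventually, for every `ε > 0`, tends to
zero as soon as `∑ γ n` diverges. -/
lemma tendsto_zero_of_le_convex_step {s γ : ℕ → ℝ} (hs : ∀ n, 0 ≤ s n)
    (hγ0 : ∀ n, 0 ≤ γ n) (hγ1 : ∀ n, γ n ≤ 1) (hγ : ¬ Summable γ)
    (h : ∀ ε > 0, ∀ᶠ n in atTop, s (n + 1) ≤ (1 - γ n) * s n + γ n * ε) :
    Tendsto s atTop (𝓝 0) := by
  have key : ∀ ε > 0, ∀ᶠ n in atTop, s n < ε := by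
    intro ε hε
    obtain ⟨N, hN⟩ := eventually_atTop.1 (h (ε / 2) (half_pos hε))
    have bound : ∀ k, s (k + N) - ε / 2 ≤
        Real.exp (-∑ i ∈ Finset.range k, γ (i + N)) * s N := by
      intro k
      induction k with
      | zero => simp; linarith
      | succ k ih =>
        have h1 := hN (k + N) (by omega)
        have h2 : s (k + 1 + N) - ε / 2 ≤ (1 - γ (k + N)) * (s (k + N) - ε / 2) := by
          rw [show k + 1 + N = k + N + 1 by omega]; linarith
        have h3 := mul_le_mul_of_nonneg_left ih (sub_nonneg.2 (hγ1 (k + N)))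
        have h4 : 1 - γ (k + N) ≤ Real.exp (-γ (k + N)) := Real.one_sub_le_exp_neg _
        have h5 : 0 ≤ Real.exp (-∑ i ∈ Finset.range k, γ (i + N)) * s N :=
          mul_nonneg (Real.exp_pos _).le (hs N)
        have h6 := mul_le_mul_of_nonneg_right h4 h5
        rw [Finset.sum_range_succ, neg_add, Real.exp_add]
        linarith
    have hsum : ¬ Summable fun i => γ (i + N) := by rwa [summable_nat_add_iff]
    have hdiv := (not_summable_iff_tendsto_nat_atTop_of_nonneg fun i => hγ0 (i + N)).1 hsum
    have hlim : Tendsto (fun k => Real.exp (-∑ i ∈ Finset.range k, γ (i + N)) * s N)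
        atTop (𝓝 0) := by
      simpa using ((Real.tendsto_exp_neg_atTop_nhds_zero.comp hdiv).mul_const (s N))
    obtain ⟨K, hK⟩ := eventually_atTop.1 (hlim.eventually_lt_const (half_pos hε))
    filter_upwards [eventually_ge_atTop (K + N)] with n hn
    have h1 := bound (n - N)
    have h2 := hK (n - N) (by omega)
    rw [Nat.sub_add_cancel (by omega)] at h1
    linarith
  exact tendsto_order.2 ⟨fun c hc => Eventually.of_forall fun n => hc.trans_le (hs n), key⟩

section Hilbert

variable {H : Type*} [NormedAddCommGroup H] [InnerProductSpace ℝ H]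

lemma norm_sq_convex_combination (t : ℝ) (u v : H) :
    ‖t • u + (1 - t) • v‖ ^ 2 =
      t * ‖u‖ ^ 2 + (1 - t) * ‖v‖ ^ 2 - t * (1 - t) * ‖u - v‖ ^ 2 := by
  rw [norm_add_sq_real, norm_sub_sq_real, inner_smul_left, inner_smul_right, norm_smul, norm_smul,
    mul_pow, mul_pow, Real.norm_eq_abs, Real.norm_eq_abs, sq_abs, sq_abs]
  simp only [conj_trivial]
  ring

/-- The fixed points of a nonexpansive self-map of a convex set form a convex set. -/
lemma convex_fixedPoints_of_nonexpansive {C : Set H} (hC : Convex ℝ C) {T : H → H}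
    (hT : ∀ x ∈ C, ∀ y ∈ C, ‖T x - T y‖ ≤ ‖x - y‖) : Convex ℝ {q | q ∈ C ∧ T q = q} := by
  rintro q ⟨hq, hTq⟩ r ⟨hr, hTr⟩ s t hs ht hst
  obtain rfl : t = 1 - s := by linarith
  have hp : s • q + (1 - s) • r ∈ C := hC hq hr hs ht hst
  refine ⟨hp, ?_⟩
  set p := s • q + (1 - s) • r with hpdef
  have h1 : ‖T p - q‖ ≤ (1 - s) * ‖r - q‖ := by
    have := hT p hp q hq
    rwa [hTq, show p - q = (1 - s) • (r - q) by rw [hpdef]; module, norm_smul,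
      Real.norm_of_nonneg ht] at this
  have h2 : ‖T p - r‖ ≤ s * ‖r - q‖ := by
    have := hT p hp r hr
    rwa [hTr, show p - r = s • (q - r) by rw [hpdef]; module, norm_smul,
      Real.norm_of_nonneg hs, norm_sub_rev q r] at this
  have h3 := norm_sq_convex_combination s (T p - q) (T p - r)
  rw [show s • (T p - q) + (1 - s) • (T p - r) = T p - p by rw [hpdef]; module,
    show T p - q - (T p - r) = r - q by abel] at h3
  have h4 := mul_le_mul_of_nonneg_left (pow_le_pow_left₀ (norm_nonneg _) h1 2) hs
  have h5 := mul_le_mul_of_nonneg_left (pow_le_pow_left₀ (norm_nonneg _) h2 2) ht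
  have h6 : ‖T p - p‖ ^ 2 ≤ 0 := by
    rw [h3]; nlinarith
  have h7 : ‖T p - p‖ = 0 := by
    have := sq_nonneg ‖T p - p‖
    exact pow_eq_zero_iff two_ne_zero |>.1 (le_antisymm h6 this)
  exact sub_eq_zero.1 (norm_eq_zero.1 h7)

/-- A bounded family in a Hilbert space converges weakly along every ultrafilter. -/
lemma exists_weak_limit_ultrafilter [CompleteSpace H] {ι : Type*} (U : Ultrafilter ι) {u : ι → H}
    {R : ℝ} (hu : ∀ i, ‖u i‖ ≤ R) :
    ∃ v : H, ∀ h : H, Tendsto (fun i => inner ℝ (u i) h) U (𝓝 (inner ℝ v h)) := by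
  let g : ι → WeakDual ℝ H := fun i => StrongDual.toWeakDual (InnerProductSpace.toDual ℝ H (u i))
  have hcomp := WeakDual.isCompact_closedBall (𝕜 := ℝ) (E := H) 0 R
  have hmem : ↑(U.map g) ≤ 𝓟 (WeakDual.toStrongDual ⁻¹' Metric.closedBall (0 : StrongDual ℝ H) R) := by
    rw [le_principal_iff]
    refine Eventually.of_forall (f := (U : Filter ι)) fun i => ?_
    simpa [g] using hu i
  obtain ⟨φ, -, hφ⟩ := hcomp.ultrafilter_le_nhds _ hmem
  have hφ' : Tendsto g U (𝓝 φ) := hφ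
  refine ⟨(InnerProductSpace.toDual ℝ H).symm (WeakDual.toStrongDual φ), fun h => ?_⟩
  have h1 := ((WeakDual.eval_continuous h).tendsto φ).comp hφ'
  rw [InnerProductSpace.toDual_symm_apply]
  exact h1

/-- Demiclosedness: weak limits of approximate fixed points of a nonexpansive map are fixed. -/
lemma mem_and_fixed_of_weak_limit [CompleteSpace H] {C : Set H} (hCne : C.Nonempty)
    (hCc : IsClosed C) (hCv : Convex ℝ C) {T : H → H}
    (hT : ∀ x ∈ C, ∀ y ∈ C, ‖T x - T y‖ ≤ ‖x - y‖) {ι : Type*} {l : Filter ι} [l.NeBot]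
    {u : ι → H} {R : ℝ} (huR : ∀ i, ‖u i‖ ≤ R) (huC : ∀ i, u i ∈ C)
    (huT : Tendsto (fun i => ‖u i - T (u i)‖) l (𝓝 0)) {v : H}
    (hv : ∀ h : H, Tendsto (fun i => inner ℝ (u i) h) l (𝓝 (inner ℝ v h))) :
    v ∈ C ∧ T v = v := by
  have hvC : v ∈ C := by
    obtain ⟨p, hp, hpv⟩ := exists_norm_eq_iInf_of_complete_convex hCne hCc.isComplete hCv v
    have hvar := (norm_eq_iInf_iff_real_inner_le_zero hCv hp).1 hpv
    have hlim : Tendsto (fun i => inner ℝ (v - p) (u i - p)) l (𝓝 (inner ℝ (v - p) (v - p))) := by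
      have := (hv (v - p)).sub_const (inner ℝ p (v - p))
      simpa only [← inner_sub_left, real_inner_comm] using this
    have h0 := le_of_tendsto' hlim fun i => hvar (u i) (huC i)
    have : v - p = 0 := real_inner_self_nonpos.1 h0
    rwa [sub_eq_zero.1 this]
  refine ⟨hvC, ?_⟩
  have hle : ∀ i, ‖v - T v‖ ^ 2 ≤ ‖u i - T (u i)‖ * (‖u i - T (u i)‖ + 2 * (R + ‖v‖))
      - 2 * (inner ℝ (u i) (v - T v) - inner ℝ v (v - T v)) := by
    intro i
    have h1 : ‖u i - T v‖ ≤ ‖u i - T (u i)‖ + ‖u i - v‖ :=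
      calc ‖u i - T v‖ ≤ ‖u i - T (u i)‖ + ‖T (u i) - T v‖ := norm_sub_le_norm_sub_add_norm_sub _ _ _
        _ ≤ _ := by gcongr; exact hT _ (huC i) _ hvC
    have h2 := norm_add_sq_real (u i - v) (v - T v)
    rw [sub_add_sub_cancel, inner_sub_left] at h2
    have h3 : ‖u i - v‖ ≤ R + ‖v‖ := (norm_sub_le _ _).trans (by gcongr; exact huR i)
    have h4 := pow_le_pow_left₀ (norm_nonneg _) h1 2
    have h5 := mul_le_mul_of_nonneg_left h3 (norm_nonneg (u i - T (u i)))
    nlinarith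
  have hlim : Tendsto (fun i => ‖u i - T (u i)‖ * (‖u i - T (u i)‖ + 2 * (R + ‖v‖))
      - 2 * (inner ℝ (u i) (v - T v) - inner ℝ v (v - T v))) l (𝓝 0) := by
    simpa using (huT.mul (huT.add_const (2 * (R + ‖v‖)))).sub
      (((hv (v - T v)).sub_const (inner ℝ v (v - T v))).const_mul 2)
  have h0 : ‖v - T v‖ ^ 2 ≤ 0 := ge_of_tendsto' hlim hle
  have h1 : ‖v - T v‖ = 0 :=
    pow_eq_zero_iff two_ne_zero |>.1 (le_antisymm h0 (sq_nonneg _))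
  exact (sub_eq_zero.1 (norm_eq_zero.1 h1)).symm

/-- If `z` is the fixed point of `T` nearest to `c`, then `⟪c - z, u i - z⟫` is asymptotically
nonpositive along bounded approximate fixed points `u i` of `T`. -/
lemma eventually_inner_lt_of_approx_fixed [CompleteSpace H] {C : Set H}
    (hCc : IsClosed C) (hCv : Convex ℝ C) {T : H → H}
    (hT : ∀ x ∈ C, ∀ y ∈ C, ‖T x - T y‖ ≤ ‖x - y‖) {c z : H} (hzC : z ∈ C) (hz : T z = z)
    (hproj : ∀ q ∈ C, T q = q → ‖c - z‖ ≤ ‖c - q‖) {ι : Type*} {l : Filter ι}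
    {u : ι → H} {R : ℝ} (huR : ∀ i, ‖u i‖ ≤ R) (huC : ∀ i, u i ∈ C)
    (huT : Tendsto (fun i => ‖u i - T (u i)‖) l (𝓝 0)) {ε : ℝ} (hε : 0 < ε) :
    ∀ᶠ i in l, inner ℝ (c - z) (u i - z) < ε := by
  by_contra hcon
  have hfreq : ∃ᶠ i in l, ¬ inner ℝ (c - z) (u i - z) < ε := not_eventually.1 hcon
  have := frequently_iff_neBot.1 hfreq
  obtain ⟨U, hUl, hU⟩ : ∃ U : Ultrafilter ι, ↑U ≤ l ∧ ∀ᶠ i in U, ¬ inner ℝ (c - z) (u i - z) < ε :=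
    let ⟨U, hU⟩ := exists_ultrafilter_iff.2 this
    ⟨U, hU.trans inf_le_left, le_principal_iff.1 (hU.trans inf_le_right)⟩
  obtain ⟨v, hv⟩ := exists_weak_limit_ultrafilter U huR
  obtain ⟨hvC, hTv⟩ := mem_and_fixed_of_weak_limit ⟨z, hzC⟩ hCc hCv hT huR huC
    (huT.mono_left hUl) hv
  have hlim : Tendsto (fun i => inner ℝ (c - z) (u i - z)) U (𝓝 (inner ℝ (c - z) (v - z))) := by
    have := (hv (c - z)).sub_const (inner ℝ z (c - z))
    simpa only [← inner_sub_left, real_inner_comm] using this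
  have hge : ε ≤ inner ℝ (c - z) (v - z) :=
    ge_of_tendsto hlim (hU.mono fun i hi => not_lt.1 hi)
  have hmin : ‖c - z‖ = ⨅ q : {q | q ∈ C ∧ T q = q}, ‖c - q‖ := by
    have : Nonempty {q | q ∈ C ∧ T q = q} := ⟨⟨z, hzC, hz⟩⟩
    refine le_antisymm (le_ciInf fun q => hproj q q.2.1 q.2.2) ?_
    exact ciInf_le (f := fun q : {q | q ∈ C ∧ T q = q} => ‖c - q‖)
      ⟨0, by rintro _ ⟨q, rfl⟩; exact norm_nonneg _⟩ ⟨z, hzC, hz⟩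
  have hvar := (norm_eq_iInf_iff_real_inner_le_zero
    (convex_fixedPoints_of_nonexpansive hCv hT) ⟨hzC, hz⟩).1 hmin v ⟨hvC, hTv⟩
  linarith

/-- One viscosity step `ν • p + (1 - ν) • y` measured against `z`, where `p` is `ρ d`-close to
`c`. -/
lemma norm_sq_viscosity_step_le {ν ρ d : ℝ} (hν0 : 0 ≤ ν) (hν1 : ν ≤ 1) (hρ0 : 0 ≤ ρ)
    (hρ1 : ρ ≤ 1) {p c y z : H} (hp : ‖p - c‖ ≤ ρ * d) :
    ‖ν • p + (1 - ν) • y - z‖ ^ 2 ≤ ν * (ρ * d ^ 2) + (1 - ν) * ‖y - z‖ ^ 2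
      + 2 * ν * inner ℝ (c - z) (ν • p + (1 - ν) • y - z) := by
  set X := ν • p + (1 - ν) • y - z with hX
  set A := ν • (p - c) + (1 - ν) • (y - z) with hA
  have hXA : A = X - ν • (c - z) := by rw [hX, hA]; module
  have h1 := norm_sub_sq_real X (ν • (c - z))
  rw [← hXA, inner_smul_right, real_inner_comm] at h1
  have h2 := norm_sq_convex_combination ν (p - c) (y - z)
  rw [← hA] at h2
  have h3 := mul_nonneg (mul_nonneg hν0 (sub_nonneg.2 hν1)) (sq_nonneg ‖p - c - (y - z)‖)
  have h4 := pow_le_pow_left₀ (norm_nonneg _) hp 2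
  have h5 : (ρ * d) ^ 2 ≤ ρ * d ^ 2 := by
    rw [mul_pow]; gcongr; nlinarith
  have h6 := mul_le_mul_of_nonneg_left (h4.trans h5) hν0
  have h7 := sq_nonneg ‖ν • (c - z)‖
  linarith

/-- One Mann step `t • w + (1 - t) • v` measured against `z`, where `v` is no farther from `z` than
`w` is. -/
lemma norm_sq_mann_step_le {t a b : ℝ} (ha : 0 ≤ a) (hb : b ≤ 1) (hat : a ≤ t) (htb : t ≤ b)
    {w v z : H} (hv : ‖v - z‖ ≤ ‖w - z‖) :
    ‖t • w + (1 - t) • v - z‖ ^ 2 ≤ ‖w - z‖ ^ 2 - a * (1 - b) * ‖w - v‖ ^ 2 := by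
  have h1 := norm_sq_convex_combination t (w - z) (v - z)
  rw [show t • (w - z) + (1 - t) • (v - z) = t • w + (1 - t) • v - z by module,
    sub_sub_sub_cancel_right] at h1
  have h2 := mul_le_mul_of_nonneg_left (pow_le_pow_left₀ (norm_nonneg _) hv 2)
    (show 0 ≤ 1 - t by linarith)
  have h3 : a * (1 - b) ≤ t * (1 - t) :=
    mul_le_mul hat (by linarith) (by linarith) (by linarith)
  have h4 := mul_le_mul_of_nonneg_right h3 (sq_nonneg ‖w - v‖)
  linarith

end Hilbert

/-- Strong convergence of the modified inertial Mann viscosity algorithm: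
`wₙ = xₙ + δₙ(xₙ - xₙ₋₁)`, `yₙ = ψₙwₙ + (1-ψₙ)Twₙ`, `xₙ₊₁ = νₙf(xₙ) + (1-νₙ)yₙ`
converges strongly to the unique `z ∈ Fix(T)` with `z = P_{Fix(T)} f(z)`. -/
theorem stmt_1 {H : Type*} [NormedAddCommGroup H] [InnerProductSpace ℝ H] [CompleteSpace H]
    (C : Set H) (hC : C.Nonempty) (hCc : IsClosed C) (hCv : Convex ℝ C)
    (T : H → H) (hTC : Set.MapsTo T C C)
    (hT : ∀ x ∈ C, ∀ y ∈ C, ‖T x - T y‖ ≤ ‖x - y‖)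
    (hfix : ∃ q ∈ C, T q = q)
    (f : H → H) (hfC : Set.MapsTo f C C) (ρ : ℝ) (hρ0 : 0 ≤ ρ) (hρ1 : ρ < 1)
    (hf : ∀ x ∈ C, ∀ y ∈ C, ‖f x - f y‖ ≤ ρ * ‖x - y‖)
    (ψ ν δ : ℕ → ℝ) (a b : ℝ) (hab : 0 < a) (hba : a ≤ b) (hb1 : b < 1)
    (hψ : ∀ n, ψ n ∈ Set.Icc a b)
    (hν : ∀ n, ν n ∈ Set.Ioo (0 : ℝ) 1) (hδ : ∀ n, 0 ≤ δ n)
    (hν0 : Tendsto ν atTop (𝓝 0)) (hνsum : ¬ Summable ν)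
    (x w y : ℕ → H)
    (hxC : ∀ n, x n ∈ C) (hwC : ∀ n, w n ∈ C)
    -- the algorithm (`x 0` plays the role of `x₋₁` and `x 1` that of `x₀`)
    (hw : ∀ n, w (n + 1) = x (n + 1) + δ (n + 1) • (x (n + 1) - x n))
    (hy : ∀ n, y (n + 1) = ψ (n + 1) • w (n + 1) + (1 - ψ (n + 1)) • T (w (n + 1)))
    (hx : ∀ n, x (n + 2) = ν (n + 1) • f (x (n + 1)) + (1 - ν (n + 1)) • y (n + 1))
    (hD2 : Tendsto (fun n => δ (n + 1) / ν (n + 1) * ‖x (n + 1) - x n‖) atTop (𝓝 0))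
    -- `z ∈ Fix(T)` satisfies `z = P_{Fix(T)} f(z)`
    (z : H) (hzC : z ∈ C) (hz : T z = z)
    (hzproj : ∀ q ∈ C, T q = q → ‖f z - z‖ ≤ ‖f z - q‖) :
    Tendsto x atTop (𝓝 z) := by
  set θ : ℕ → ℝ := fun n => δ (n + 1) / ν (n + 1) * ‖x (n + 1) - x n‖ with hθ
  have hν0' : ∀ n, 0 < ν n := fun n => (hν n).1
  have hν1' : ∀ n, ν n < 1 := fun n => (hν n).2
  have hθ0 : ∀ n, 0 ≤ θ n := fun n =>
    mul_nonneg (div_nonneg (hδ _) (hν0' _).le) (norm_nonneg _)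
  obtain ⟨M, hM'⟩ := hD2.bddAbove_range
  have hM : ∀ n, θ n ≤ M := fun n => hM' ⟨n, rfl⟩
  have hM0 : 0 ≤ M := (hθ0 0).trans (hM 0)
  have hρ : 0 < 1 - ρ := sub_pos.2 hρ1
  have hwz : ∀ n, ‖w (n + 1) - z‖ ≤ ‖x (n + 1) - z‖ + ν (n + 1) * θ n := by
    intro n
    have h1 : ν (n + 1) * θ n = ‖δ (n + 1) • (x (n + 1) - x n)‖ := by
      have := (hν0' (n + 1)).ne'
      rw [norm_smul, Real.norm_of_nonneg (hδ _), hθ]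
      field_simp
    rw [h1, hw n, show x (n + 1) + δ (n + 1) • (x (n + 1) - x n) - z
      = (x (n + 1) - z) + δ (n + 1) • (x (n + 1) - x n) by abel]
    exact norm_add_le _ _
  have hTw : ∀ n, ‖T (w (n + 1)) - z‖ ≤ ‖w (n + 1) - z‖ := by
    intro n
    simpa only [hz] using hT _ (hwC (n + 1)) z hzC
  have hmann : ∀ n, ‖y (n + 1) - z‖ ^ 2 ≤
      ‖w (n + 1) - z‖ ^ 2 - a * (1 - b) * ‖w (n + 1) - T (w (n + 1))‖ ^ 2 := by
    intro n
    rw [hy n]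
    exact norm_sq_mann_step_le hab.le hb1.le (hψ _).1 (hψ _).2 (hTw n)
  have hab' : 0 < a * (1 - b) := mul_pos hab (sub_pos.2 hb1)
  have hyz : ∀ n, ‖y (n + 1) - z‖ ≤ ‖w (n + 1) - z‖ := by
    intro n
    refine (le_abs_self _).trans (abs_le_of_sq_le_sq ((hmann n).trans ?_) (norm_nonneg _))
    exact sub_le_self _ (mul_nonneg hab'.le (sq_nonneg _))
  have hfx : ∀ n, ‖f (x n) - f z‖ ≤ ρ * ‖x n - z‖ := fun n => hf _ (hxC n) _ hzC
  -- boundedness of the iterates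
  obtain ⟨R, hR0, hR⟩ : ∃ R, 0 ≤ R ∧ ∀ n, ‖x (n + 1) - z‖ ≤ R := by
    refine ⟨max ‖x 1 - z‖ ((‖f z - z‖ + M) / (1 - ρ)), le_max_of_le_left (norm_nonneg _), ?_⟩
    intro n
    induction n with
    | zero => exact le_max_left _ _
    | succ n ih =>
      set R := max ‖x 1 - z‖ ((‖f z - z‖ + M) / (1 - ρ))
      have h1 : ‖f z - z‖ + M ≤ R * (1 - ρ) := (div_le_iff₀ hρ).1 (le_max_right _ _)
      have hn0 := hν0' (n + 1)
      have hn1 := hν1' (n + 1)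
      have h2 : ‖x (n + 2) - z‖ ≤
          ν (n + 1) * ‖f (x (n + 1)) - z‖ + (1 - ν (n + 1)) * ‖y (n + 1) - z‖ := by
        rw [hx n, show ν (n + 1) • f (x (n + 1)) + (1 - ν (n + 1)) • y (n + 1) - z
          = ν (n + 1) • (f (x (n + 1)) - z) + (1 - ν (n + 1)) • (y (n + 1) - z) by module]
        refine (norm_add_le _ _).trans_eq ?_
        rw [norm_smul, norm_smul, Real.norm_of_nonneg hn0.le, Real.norm_of_nonneg (by linarith)]
      have h3 : ‖f (x (n + 1)) - z‖ ≤ ρ * R + ‖f z - z‖ :=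
        (norm_sub_le_norm_sub_add_norm_sub _ (f z) _).trans
          (by gcongr; exact (hfx _).trans (by gcongr))
      have h4 : ‖y (n + 1) - z‖ ≤ R + ν (n + 1) * M :=
        (hyz n).trans ((hwz n).trans (by gcongr; exact hM n))
      have h5 := mul_le_mul_of_nonneg_left h3 hn0.le
      have h6 := mul_le_mul_of_nonneg_left h4 (sub_nonneg.2 hn1.le)
      have h7 := mul_le_mul_of_nonneg_left h1 hn0.le
      have h8 := mul_nonneg (mul_nonneg hn0.le hn0.le) hM0
      show ‖x (n + 2) - z‖ ≤ R
      linarith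
  have hwR : ∀ n, ‖w (n + 1) - z‖ ≤ R + M := by
    intro n
    refine (hwz n).trans (add_le_add (hR n) ?_)
    exact (mul_le_of_le_one_left (hθ0 n) (hν1' _).le).trans (hM n)
  -- the quadratic recursion
  set K := 2 * R + M with hK
  have hK0 : 0 ≤ K := by positivity
  set g : ℕ → ℝ := fun n => ‖w (n + 1) - T (w (n + 1))‖ with hg
  have hg0 : ∀ n, 0 ≤ g n := fun n => norm_nonneg _
  set I : ℕ → ℝ := fun n => inner ℝ (f z - z) (x (n + 2) - z) with hI
  have hrec : ∀ n, ‖x (n + 2) - z‖ ^ 2 ≤ (1 - ν (n + 1) * (1 - ρ)) * ‖x (n + 1) - z‖ ^ 2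
      + (ν (n + 1) * (θ n * K + 2 * I n) - (1 - ν (n + 1)) * (a * (1 - b)) * g n ^ 2) := by
    intro n
    have hn0 := hν0' (n + 1)
    have hn1 := hν1' (n + 1)
    have h1 := norm_sq_viscosity_step_le (y := y (n + 1)) (z := z) hn0.le hn1.le hρ0 hρ1.le
      (hfx (n + 1))
    rw [← hx n] at h1
    have h2 : ‖w (n + 1) - z‖ ^ 2 ≤ ‖x (n + 1) - z‖ ^ 2 + ν (n + 1) * (θ n * K) := by
      have hνθ : 0 ≤ ν (n + 1) * θ n := mul_nonneg hn0.le (hθ0 n)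
      have h3 := pow_le_pow_left₀ (norm_nonneg _) (hwz n) 2
      have h4 : ν (n + 1) * θ n ≤ M := (mul_le_of_le_one_left (hθ0 n) hn1.le).trans (hM n)
      have h5 : 2 * ‖x (n + 1) - z‖ + ν (n + 1) * θ n ≤ K := by linarith [hR n]
      have h6 := mul_le_mul_of_nonneg_left h5 hνθ
      linarith
    have h3 := mul_le_mul_of_nonneg_left ((hmann n).trans (sub_le_sub_right h2 _))
      (sub_nonneg.2 hn1.le)
    have h4 : 0 ≤ ν (n + 1) * (ν (n + 1) * (θ n * K)) :=
      mul_nonneg hn0.le (mul_nonneg hn0.le (mul_nonneg (hθ0 n) hK0))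
    simp only [hI, hg]
    linarith
  have hνs : Tendsto (fun n => ν (n + 1)) atTop (𝓝 0) := (tendsto_add_atTop_iff_nat 1).2 hν0
  set F := ‖f z - z‖ with hF
  have hF0 : 0 ≤ F := norm_nonneg _
  have hIle : ∀ n, I n ≤ F * R := fun n =>
    (real_inner_le_norm _ _).trans (mul_le_mul_of_nonneg_left (hR (n + 1)) hF0)
  have hxw : ∀ n, ‖x (n + 2) - w (n + 1)‖ ≤ ν (n + 1) * (R + F + (R + M)) + g n := by
    intro n
    have hn0 := hν0' (n + 1)
    have hn1 := hν1' (n + 1)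
    have hp1 : 0 ≤ 1 - ψ (n + 1) := by linarith [(hψ (n + 1)).2]
    have hp2 : 1 - ψ (n + 1) ≤ 1 := by linarith [(hψ (n + 1)).1]
    have h1 : x (n + 2) - w (n + 1) = ν (n + 1) • (f (x (n + 1)) - w (n + 1))
        - ((1 - ν (n + 1)) * (1 - ψ (n + 1))) • (w (n + 1) - T (w (n + 1))) := by
      rw [hx n, hy n]; module
    rw [h1]
    refine (norm_sub_le _ _).trans ?_
    rw [norm_smul, norm_smul, Real.norm_of_nonneg hn0.le,
      Real.norm_of_nonneg (mul_nonneg (sub_nonneg.2 hn1.le) hp1)]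
    refine add_le_add (mul_le_mul_of_nonneg_left ?_ hn0.le)
      (mul_le_of_le_one_left (norm_nonneg _) (mul_le_one₀ (by linarith) hp1 hp2))
    calc ‖f (x (n + 1)) - w (n + 1)‖
        = ‖(f (x (n + 1)) - f z) + (f z - z) - (w (n + 1) - z)‖ := by congr 1; abel
      _ ≤ ‖f (x (n + 1)) - f z‖ + ‖f z - z‖ + ‖w (n + 1) - z‖ :=
        (norm_sub_le _ _).trans (by gcongr; exact norm_add_le _ _)
      _ ≤ R + F + (R + M) := by
        gcongr
        · exact (hfx _).trans ((mul_le_of_le_one_left (norm_nonneg _) hρ1.le).trans (hR n))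
        · exact hwR n
  have hgood : ∀ ε > 0, ∀ᶠ n in atTop, ν (n + 1) * (θ n * K + 2 * I n)
      - (1 - ν (n + 1)) * (a * (1 - b)) * g n ^ 2 ≤ ν (n + 1) * ε := by
    intro ε hε
    set B : Set ℕ := {n | ν (n + 1) * ε < ν (n + 1) * (θ n * K + 2 * I n)
      - (1 - ν (n + 1)) * (a * (1 - b)) * g n ^ 2} with hB
    have hl : atTop ⊓ 𝓟 B ≤ atTop := inf_le_left
    have hgl : Tendsto g (atTop ⊓ 𝓟 B) (𝓝 0) := by
      have hsq : Tendsto (fun n => g n ^ 2) (atTop ⊓ 𝓟 B) (𝓝 0) := by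
        have hup : Tendsto (fun n => ν (n + 1) * (2 * (M * K + 2 * (F * R)) / (a * (1 - b))))
            (atTop ⊓ 𝓟 B) (𝓝 0) := by
          simpa using (hνs.mono_left hl).mul_const (2 * (M * K + 2 * (F * R)) / (a * (1 - b)))
        refine squeeze_zero' (Eventually.of_forall fun n => sq_nonneg _) ?_ hup
        have hhalf : ∀ᶠ n in atTop, ν (n + 1) < 1 / 2 :=
          hνs.eventually_lt_const (by norm_num)
        refine eventually_inf_principal.2 (hhalf.mono fun n hn hnB => ?_)
        have hn0 := hν0' (n + 1)
        have h1 : ν (n + 1) * (θ n * K + 2 * I n) ≤ ν (n + 1) * (M * K + 2 * (F * R)) := by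
          gcongr
          · exact hM n
          · exact hIle n
        have h2 : 1 / 2 * (a * (1 - b) * g n ^ 2) ≤ (1 - ν (n + 1)) * (a * (1 - b) * g n ^ 2) :=
          mul_le_mul_of_nonneg_right (by linarith) (mul_nonneg hab'.le (sq_nonneg _))
        have h3 : 0 < ν (n + 1) * ε := mul_pos hn0 hε
        have h4 : ν (n + 1) * ε < _ := hnB
        rw [← mul_div_assoc, le_div_iff₀ hab']
        linarith
      have := hsq.sqrt
      simpa [Real.sqrt_sq (hg0 _)] using this
    have hweak := eventually_inner_lt_of_approx_fixed hCc hCv hT hzC hz hzproj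
      (u := fun n => w (n + 1)) (R := R + M + ‖z‖)
      (fun n => (norm_le_norm_sub_add _ z).trans (by gcongr; exact hwR n))
      (fun n => hwC (n + 1)) hgl (show 0 < ε / 4 by linarith)
    have hrest : Tendsto (fun n => θ n * K + 2 * (F * (ν (n + 1) * (R + F + (R + M)) + g n)))
        (atTop ⊓ 𝓟 B) (𝓝 0) := by
      simpa using ((hD2.mono_left hl).mul_const K).add
        (((((hνs.mono_left hl).mul_const (R + F + (R + M))).add hgl).const_mul F).const_mul 2)
    have hev := hweak.and (hrest.eventually_lt_const (half_pos hε))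
    refine (eventually_inf_principal.1 hev).mono fun n hn => ?_
    by_contra hcon
    obtain ⟨h1, h2⟩ := hn (not_le.1 hcon)
    apply hcon
    have h3 : I n ≤ inner ℝ (f z - z) (w (n + 1) - z)
        + F * (ν (n + 1) * (R + F + (R + M)) + g n) := by
      have h4 : I n = inner ℝ (f z - z) (w (n + 1) - z)
          + inner ℝ (f z - z) (x (n + 2) - w (n + 1)) := by
        rw [← inner_add_right, sub_add_sub_cancel']
      rw [h4]
      gcongr
      exact (real_inner_le_norm _ _).trans (mul_le_mul_of_nonneg_left (hxw n) hF0)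
    have h5 : θ n * K + 2 * I n ≤ ε := by linarith
    have h6 := mul_le_mul_of_nonneg_left h5 (hν0' (n + 1)).le
    have h7 : 0 ≤ (1 - ν (n + 1)) * (a * (1 - b)) * g n ^ 2 :=
      mul_nonneg (mul_nonneg (sub_nonneg.2 (hν1' _).le) hab'.le) (sq_nonneg _)
    linarith
  have hsq : Tendsto (fun n => ‖x (n + 1) - z‖ ^ 2) atTop (𝓝 0) := by
    refine tendsto_zero_of_le_convex_step (γ := fun n => ν (n + 1) * (1 - ρ))
      (fun n => sq_nonneg _) (fun n => mul_nonneg (hν0' _).le hρ.le)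
      (fun n => mul_le_one₀ (hν1' _).le hρ.le (by linarith)) ?_ fun ε hε => ?_
    · rwa [summable_mul_right_iff hρ.ne', summable_nat_add_iff 1]
    · filter_upwards [hgood ((1 - ρ) * ε) (mul_pos hρ hε)] with n hn
      have := hrec n
      rw [show n + 1 + 1 = n + 2 from rfl]
      linarith
  have hnorm : Tendsto (fun n => ‖x (n + 1) - z‖) atTop (𝓝 0) := by
    simpa using hsq.sqrt
  exact (tendsto_add_atTop_iff_nat 1).1 (tendsto_iff_norm_sub_tendsto_zero.2 hnorm)
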